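/- For all integers k ≥ d ≥ 2, the Ranking algorithm is at most (1 − ((1−1/d)^k · (d−1))/(k+d−1))-competitive for online bipartite matching on (k,d)-bounded graphs: there exists a (k,d)-bounded bipartite graph with an arrival order of its requests on which the expected size of the matching produced by Ranking is at most (1 − ((1−1/d)^k · (d−1))/(k+d−1)) times the size of a maximum matching. -/

import Mathlib

open MeasureTheory

/-- The uniform probability measure on the cube `[0,1]^n`. -/
noncomputable def uniformCube (n : ℕ) : Measure (Fin n → ℝ) :=
  Measure.pi fun _ => volume.restrict (Set.Icc (0 : ℝ) 1)

/-- One step of the Ranking algorithm: a request with neighborhood `N` is matched to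
its currently unmatched neighbor of least rank (if any). -/
noncomputable def rankingStep {n : ℕ} (y : Fin n → ℝ) (M N : Finset (Fin n)) :
    Finset (Fin n) :=
  match List.argmin y (N \ M).toList with
  | some s => insert s M
  | none => M

/-- The set of servers matched by the Ranking algorithm with server ranks `y`, when the
requests arrive in the order of the list `Ns` of their neighborhoods. -/
noncomputable def rankingMatched {n : ℕ} (y : Fin n → ℝ) (Ns : List (Finset (Fin n))) :
    Finset (Fin n) :=
  Ns.foldl (rankingStep y) ∅

/-- `g` is a matching of the bipartite graph whose requests (in arrival order) have
neighborhoods `Ns`. -/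
def IsMatching {ns : ℕ} (Ns : List (Finset (Fin ns)))
    (g : Fin Ns.length → Option (Fin ns)) : Prop :=
  (∀ i s, g i = some s → s ∈ Ns.get i) ∧
    ∀ i j s, g i = some s → g j = some s → i = j

/-- The number of edges of the matching `g`. -/
def matchingSize {ns : ℕ} (Ns : List (Finset (Fin ns)))
    (g : Fin Ns.length → Option (Fin ns)) : ℕ :=
  (Finset.univ.filter fun i => (g i).isSome).card

open scoped ENNReal

/-- The rank vectors in which `s` has strictly smaller rank than every element of `B`. -/
def strictMinSet {ι : Type*} (B : Finset ι) (s : ι) : Set (ι → ℝ) :=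
  {x | ∀ t ∈ B, x s < x t}

/-- A measurable lower bound for the number of servers of `A` that remain unmatched after the
requests `insert g A`, for `g` in the given list, have been processed. -/
noncomputable def unmatchedBound {ι : Type*} [DecidableEq ι] :
    List ι → Finset ι → (ι → ℝ) → ℝ≥0∞
  | [], A, _ => A.card
  | g :: L, A, x => ∑ s ∈ A, (strictMinSet (A.erase s) s).indicator
      (fun x => {x : ι → ℝ | x g < x s}.indicator (unmatchedBound L A) x +
        {x : ι → ℝ | x s < x g}.indicator (unmatchedBound L (A.erase s)) x) x

section Bound

variable {ι : Type*}

theorem measurableSet_strictMinSet (B : Finset ι) (s : ι) :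
    MeasurableSet (strictMinSet B s) := by
  have : strictMinSet B s = ⋂ t ∈ B, {x | x s < x t} := by
    ext x; simp [strictMinSet]
  rw [this]
  exact B.measurableSet_biInter fun t _ =>
    measurableSet_lt (measurable_pi_apply s) (measurable_pi_apply t)

variable [DecidableEq ι]

theorem measurable_unmatchedBound (L : List ι) (A : Finset ι) :
    Measurable (unmatchedBound L A) := by
  induction L generalizing A with
  | nil => exact measurable_const
  | cons g L ih =>
    refine Finset.measurable_fun_sum _ fun s _ => Measurable.indicator ?_
      (measurableSet_strictMinSet _ _)
    exact ((ih _).indicator (measurableSet_lt (measurable_pi_apply _) (measurable_pi_apply _))).add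
      ((ih _).indicator (measurableSet_lt (measurable_pi_apply _) (measurable_pi_apply _)))

theorem unmatchedBound_congr (L : List ι) (A : Finset ι) {x y : ι → ℝ}
    (hA : ∀ i ∈ A, x i = y i) (hL : ∀ i ∈ L, x i = y i) :
    unmatchedBound L A x = unmatchedBound L A y := by
  induction L generalizing A with
  | nil => rfl
  | cons g L ih =>
    have hg := hL g (by simp)
    have hL' : ∀ i ∈ L, x i = y i := fun i hi => hL i (by simp [hi])
    refine Finset.sum_congr rfl fun s hs => ?_
    have h1 : x ∈ strictMinSet (A.erase s) s ↔ y ∈ strictMinSet (A.erase s) s := by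
      refine forall₂_congr fun t ht => ?_
      rw [hA s hs, hA t (Finset.mem_of_mem_erase ht)]
    have h2 := ih A hA hL'
    have h3 := ih (A.erase s) (fun i hi => hA i (Finset.mem_of_mem_erase hi)) hL'
    by_cases hx : x ∈ strictMinSet (A.erase s) s
    · rw [Set.indicator_of_mem hx, Set.indicator_of_mem (h1.1 hx)]
      simp only [Set.indicator_apply, Set.mem_ofPred_eq, hg, hA s hs, h2, h3]
    · rw [Set.indicator_of_notMem hx, Set.indicator_of_notMem (h1.not.1 hx)]

theorem indicator_strictMinSet_le_unmatchedBound_cons (g : ι) (L : List ι) {B : Finset ι} {s : ι}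
    (hs : s ∉ B) (x : ι → ℝ) (hx : x ∈ strictMinSet B s) :
    {x : ι → ℝ | x g < x s}.indicator (unmatchedBound L (insert s B)) x +
        {x : ι → ℝ | x s < x g}.indicator (unmatchedBound L B) x ≤
      unmatchedBound (g :: L) (insert s B) x := by
  rw [unmatchedBound]
  refine le_trans ?_ (Finset.single_le_sum (fun _ _ => zero_le) (Finset.mem_insert_self s B))
  rw [Finset.erase_insert hs, Set.indicator_of_mem hx]

theorem tangent_line_le_pow {a b : ℝ} (ha : 0 < a) (hb : 0 ≤ b) (k : ℕ) :
    a ^ k + k * a ^ (k - 1) * (b - a) ≤ b ^ k := by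
  rcases k with _ | k
  · simp
  have h := one_add_mul_le_pow (a := b / a - 1) (by have := div_nonneg hb ha.le; linarith) (k + 1)
  have h2 := mul_le_mul_of_nonneg_left h (pow_pos ha (k + 1)).le
  rw [← mul_pow] at h2
  have e : a * (1 + (b / a - 1)) = b := by field_simp; ring
  rw [e] at h2
  refine le_trans (le_of_eq ?_) h2
  push_cast
  field_simp
  ring

theorem le_integral_pow_mul_pow (m k : ℕ) {v : ℝ} (h0 : 0 ≤ v) (h1 : v ≤ 1) :
    v ^ (m + 1) * (1 - v / (m + 2)) ^ k ≤
      ∫ u in (0 : ℝ)..v, u ^ m * (m + 1) * (1 - u / (m + 1)) ^ k := by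
  have hm : (0 : ℝ) < m + 1 := by positivity
  set a : ℝ := 1 - v / (m + 2) with ha_def
  have ha : 0 < a := by
    rw [ha_def, sub_pos, div_lt_one (by positivity)]; linarith
  have hle : ∀ u ∈ Set.Icc (0 : ℝ) v,
      u ^ m * (m + 1) * (a ^ k + k * a ^ (k - 1) * ((1 - u / (m + 1)) - a)) ≤
        u ^ m * (m + 1) * (1 - u / (m + 1)) ^ k := by
    intro u hu
    refine mul_le_mul_of_nonneg_left (tangent_line_le_pow ha ?_ k)
      (mul_nonneg (pow_nonneg hu.1 _) hm.le)
    rw [sub_nonneg, div_le_one hm]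
    linarith [hu.2, (Nat.cast_nonneg m : (0 : ℝ) ≤ m)]
  refine le_trans (le_of_eq ?_) (intervalIntegral.integral_mono_on h0 ?_ ?_ hle)
  · have e : ∀ u : ℝ, u ^ m * (m + 1) * (a ^ k + k * a ^ (k - 1) * ((1 - u / (m + 1)) - a)) =
        ((m + 1) * (a ^ k + k * a ^ (k - 1) * (1 - a))) * u ^ m
          - (k * a ^ (k - 1)) * u ^ (m + 1) := by
      intro u; field_simp; ring
    simp_rw [e]
    rw [intervalIntegral.integral_sub (Continuous.intervalIntegrable (by fun_prop) _ _)
        (Continuous.intervalIntegrable (by fun_prop) _ _),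
      intervalIntegral.integral_const_mul, intervalIntegral.integral_const_mul,
      integral_pow, integral_pow]
    have : 1 - a = v / (m + 2) := by rw [ha_def]; ring
    rw [this]
    push_cast
    simp only [ne_eq, Nat.add_eq_zero_iff, one_ne_zero, and_false, not_false_eq_true, zero_pow]
    have : (m : ℝ) + 1 + 1 = m + 2 := by ring
    rw [this]
    field_simp
    ring
  · exact Continuous.intervalIntegrable (by fun_prop) _ _
  · exact Continuous.intervalIntegrable (by fun_prop) _ _

theorem sum_indicator_strictMinSet_le (A : Finset ι) (f : ι → (ι → ℝ) → ℝ≥0∞) (x : ι → ℝ)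
    (C : ℝ≥0∞) (h : ∀ s ∈ A, x ∈ strictMinSet (A.erase s) s → f s x ≤ C) :
    ∑ s ∈ A, (strictMinSet (A.erase s) s).indicator (f s) x ≤ C := by
  by_cases hex : ∃ s ∈ A, x ∈ strictMinSet (A.erase s) s
  · obtain ⟨s, hs, hx⟩ := hex
    rw [Finset.sum_eq_single_of_mem s hs, Set.indicator_of_mem hx]
    · exact h s hs hx
    · intro t ht hts
      refine Set.indicator_of_notMem (fun hxt => ?_) _
      exact lt_asymm (hx t (Finset.mem_erase.2 ⟨hts, ht⟩))
        (hxt s (Finset.mem_erase.2 ⟨hts.symm, hs⟩))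
  · push Not at hex
    rw [Finset.sum_eq_zero fun s hs => Set.indicator_of_notMem (hex s hs) _]
    exact zero_le

theorem volume_restrict_Icc_Ioi {c : ℝ} (hc : 0 ≤ c) :
    (volume.restrict (Set.Icc (0 : ℝ) 1)) (Set.Ioi c) = ENNReal.ofReal (1 - c) := by
  rw [Measure.restrict_apply measurableSet_Ioi]
  have : Set.Ioi c ∩ Set.Icc (0 : ℝ) 1 = Set.Ioc c 1 := by
    ext z
    simp only [Set.mem_inter_iff, Set.mem_Ioi, Set.mem_Icc, Set.mem_Ioc]
    constructor
    · rintro ⟨h1, h2, h3⟩; exact ⟨h1, h3⟩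
    · rintro ⟨h1, h3⟩; exact ⟨h1, by linarith, h3⟩
  rw [this, Real.volume_Ioc]

theorem volume_restrict_Icc_Iio {c : ℝ} (hc : c ≤ 1) :
    (volume.restrict (Set.Icc (0 : ℝ) 1)) (Set.Iio c) = ENNReal.ofReal c := by
  rw [Measure.restrict_apply measurableSet_Iio]
  have : Set.Iio c ∩ Set.Icc (0 : ℝ) 1 = Set.Ico 0 c := by
    ext z
    simp only [Set.mem_inter_iff, Set.mem_Iio, Set.mem_Icc, Set.mem_Ico]
    constructor
    · rintro ⟨h1, h2, h3⟩; exact ⟨h2, h1⟩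
    · rintro ⟨h1, h3⟩; exact ⟨h3, h1, by linarith⟩
  rw [this, Real.volume_Ico, sub_zero]

theorem lmarginal_indicator_strictMinSet_const (B : Finset ι) {s : ι} (hs : s ∉ B) (C : ℝ≥0∞)
    (x : ι → ℝ) (hx : 0 ≤ x s) :
    lmarginal (fun _ : ι => volume.restrict (Set.Icc (0 : ℝ) 1)) B
      ((strictMinSet B s).indicator fun _ => C) x = C * ENNReal.ofReal (1 - x s) ^ B.card := by
  have h : ∀ y : B → ℝ, (strictMinSet B s).indicator (fun _ => C) (Function.updateFinset x B y) =
      (Set.univ.pi fun _ : B => Set.Ioi (x s)).indicator (fun _ => C) y := by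
    intro y
    have hiff : Function.updateFinset x B y ∈ strictMinSet B s ↔
        y ∈ Set.univ.pi fun _ : B => Set.Ioi (x s) := by
      simp only [strictMinSet, Set.mem_ofPred_eq, Set.mem_pi, Set.mem_univ, Set.mem_Ioi,
        Function.updateFinset, hs, dif_neg, not_false_eq_true, true_imp_iff, Subtype.forall]
      refine forall₂_congr fun t ht => ?_
      rw [dif_pos ht]
    by_cases hy : y ∈ Set.univ.pi fun _ : B => Set.Ioi (x s)
    · rw [Set.indicator_of_mem hy, Set.indicator_of_mem (hiff.2 hy)]
    · rw [Set.indicator_of_notMem hy, Set.indicator_of_notMem (hiff.not.2 hy)]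
  simp only [lmarginal, h]
  rw [lintegral_indicator_const (MeasurableSet.univ_pi fun _ => measurableSet_Ioi),
    Measure.pi_pi]
  simp [volume_restrict_Icc_Ioi hx]

/-- The expected number of unmatched elements of `insert s B` is large, given that `s` has the
smallest rank among them. -/
def LeStrictMinMarginal (L : List ι) (B : Finset ι) (s : ι) (x : ι → ℝ) : Prop :=
  ENNReal.ofReal ((1 - x s) ^ B.card * (B.card + 1) *
      (1 - (1 - x s) / (B.card + 1)) ^ L.length) ≤
    lmarginal (fun _ : ι => volume.restrict (Set.Icc (0 : ℝ) 1)) (B ∪ L.toFinset)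
      ((strictMinSet B s).indicator (unmatchedBound L (insert s B))) x

theorem le_lmarginal_of_leStrictMinMarginal (L : List ι) (B : Finset ι)
    (hL : ∀ g ∈ L, g ∉ B)
    (ih : ∀ s ∈ B, ∀ x : ι → ℝ, x s ∈ Set.Icc (0 : ℝ) 1 → LeStrictMinMarginal L (B.erase s) s x)
    {c : ℝ} (h0 : 0 ≤ c) (h1 : c ≤ 1) (x : ι → ℝ) :
    ENNReal.ofReal (B.card * (1 - c) ^ B.card * (1 - (1 - c) / (B.card + 1)) ^ L.length) ≤
    lmarginal (fun _ : ι => volume.restrict (Set.Icc (0 : ℝ) 1)) (B ∪ L.toFinset)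
      ({x | ∀ t ∈ B, c < x t}.indicator (unmatchedBound L B)) x := by
  set μ : ι → Measure ℝ := fun _ : ι => volume.restrict (Set.Icc (0 : ℝ) 1)
  rcases B.eq_empty_or_nonempty with rfl | hB
  · simp
  obtain ⟨m, hm⟩ : ∃ m, B.card = m + 1 := ⟨B.card - 1, by have := hB.card_pos; omega⟩
  let f : ι → (ι → ℝ) → ℝ≥0∞ := fun s => {x | c < x s}.indicator
    ((strictMinSet (B.erase s) s).indicator (unmatchedBound L B))
  have hf : ∀ s, Measurable (f s) := fun s =>
    ((measurable_unmatchedBound L B).indicator (measurableSet_strictMinSet _ _)).indicator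
      (measurableSet_lt measurable_const (measurable_pi_apply s))
  have hle : (fun x => ∑ s ∈ B, f s x) ≤
      {x | ∀ t ∈ B, c < x t}.indicator (unmatchedBound L B) := by
    intro x
    simp only [f, Set.indicator_indicator, Set.inter_comm {x : ι → ℝ | c < x _}]
    simp only [← Set.indicator_indicator]
    refine sum_indicator_strictMinSet_le _ _ _ _ fun s hs hx => ?_
    by_cases hc : c < x s
    · rw [Set.indicator_of_mem (by exact hc), Set.indicator_of_mem]
      intro t ht
      by_cases hts : t = s
      · rwa [hts]
      · exact hc.trans (hx t (Finset.mem_erase.2 ⟨hts, ht⟩))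
    · rw [Set.indicator_of_notMem (by exact hc)]
      exact zero_le
  refine le_trans ?_ (lmarginal_mono hle x)
  have hsum : lmarginal μ (B ∪ L.toFinset) (fun x => ∑ s ∈ B, f s x) x =
      ∑ s ∈ B, lmarginal μ (B ∪ L.toFinset) (f s) x := by
    simp only [lmarginal]
    exact lintegral_finsetSum _ fun s _ => (hf s).comp measurable_updateFinset
  rw [hsum]
  have hterm : ∀ s ∈ B, ENNReal.ofReal ((1 - c) ^ (m + 1) * (1 - (1 - c) / (m + 2)) ^ L.length) ≤
      lmarginal μ (B ∪ L.toFinset) (f s) x := by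
    intro s hs
    have hcard : (B.erase s).card = m := by rw [Finset.card_erase_of_mem hs, hm]; rfl
    have hset : B ∪ L.toFinset = insert s (B.erase s ∪ L.toFinset) := by
      rw [← Finset.insert_union, Finset.insert_erase hs]
    have hsn : s ∉ B.erase s ∪ L.toFinset := by
      simp only [Finset.mem_union, Finset.mem_erase, List.mem_toFinset]
      rintro (h | h)
      · exact h.1 rfl
      · exact hL s h hs
    rw [hset, lmarginal_insert _ (hf s) hsn]
    let φ : ℝ → ℝ := fun u => u ^ m * (m + 1) * (1 - u / (m + 1)) ^ L.length
    have hφ : ∀ z ∈ Set.Ioc c 1, ENNReal.ofReal (φ (1 - z)) ≤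
        lmarginal μ (B.erase s ∪ L.toFinset) (f s) (Function.update x s z) := by
      intro z hz
      have := ih s hs (Function.update x s z)
        (by rw [Function.update_self]; exact ⟨h0.trans hz.1.le, hz.2⟩)
      rw [LeStrictMinMarginal, Finset.insert_erase hs, Function.update_self, hcard] at this
      refine this.trans (le_of_eq (lintegral_congr fun y => ?_))
      refine (Set.indicator_of_mem (s := {x : ι → ℝ | c < x s}) ?_ _).symm
      simpa [Function.updateFinset, hsn] using hz.1
    calc ENNReal.ofReal ((1 - c) ^ (m + 1) * (1 - (1 - c) / (m + 2)) ^ L.length)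
        ≤ ENNReal.ofReal (∫ u in (0 : ℝ)..(1 - c), φ u) :=
          ENNReal.ofReal_le_ofReal
            (le_integral_pow_mul_pow m _ (by linarith) (by linarith))
      _ = ENNReal.ofReal (∫ z in Set.Ioc c 1, φ (1 - z)) := by
          rw [← intervalIntegral.integral_of_le h1, intervalIntegral.integral_comp_sub_left φ 1,
            sub_self]
      _ = ∫⁻ z in Set.Ioc c 1, ENNReal.ofReal (φ (1 - z)) := by
          refine ofReal_integral_eq_lintegral_ofReal ?_ ?_
          · exact (Continuous.integrableOn_Icc (by fun_prop)).mono_set Set.Ioc_subset_Icc_self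
          · filter_upwards [ae_restrict_mem measurableSet_Ioc] with z hz
            refine mul_nonneg (mul_nonneg (pow_nonneg (by linarith [hz.2]) _) (by positivity))
              (pow_nonneg ?_ _)
            rw [sub_nonneg, div_le_one (by positivity)]
            linarith [hz.1, (Nat.cast_nonneg m : (0 : ℝ) ≤ m)]
      _ ≤ ∫⁻ z in Set.Ioc c 1,
            lmarginal μ (B.erase s ∪ L.toFinset) (f s) (Function.update x s z) :=
          setLIntegral_mono' measurableSet_Ioc hφ
      _ ≤ _ :=
          have hsub : Set.Ioc c 1 ⊆ Set.Icc 0 1 := fun z hz => ⟨h0.trans hz.1.le, hz.2⟩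
          lintegral_mono' (Measure.restrict_mono hsub le_rfl) le_rfl
  refine le_trans ?_ (Finset.sum_le_sum hterm)
  rw [Finset.sum_const, nsmul_eq_mul, ← ENNReal.ofReal_natCast, ← ENNReal.ofReal_mul (by positivity),
    hm]
  refine ENNReal.ofReal_le_ofReal (le_of_eq ?_)
  push_cast
  ring

theorem leStrictMinMarginal (L : List ι) (B : Finset ι) {s : ι} (hs : s ∉ B) (hnd : L.Nodup)
    (hL : ∀ g ∈ L, g ∉ insert s B) (x : ι → ℝ) (hx : x s ∈ Set.Icc (0 : ℝ) 1) :
    LeStrictMinMarginal L B s x := by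
  induction L generalizing B s x with
  | nil =>
    rw [LeStrictMinMarginal]
    have hC : unmatchedBound [] (insert s B) = fun _ : ι → ℝ => ENNReal.ofReal (B.card + 1) := by
      funext y
      rw [unmatchedBound, Finset.card_insert_of_notMem hs, ← ENNReal.ofReal_natCast]
      push_cast
      rfl
    rw [hC, List.toFinset_nil, Finset.union_empty,
      lmarginal_indicator_strictMinSet_const B hs _ x hx.1,
      ← ENNReal.ofReal_pow (by linarith [hx.2]), ← ENNReal.ofReal_mul (by positivity)]
    refine ENNReal.ofReal_le_ofReal (le_of_eq ?_)
    simp [mul_comm]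
  | cons g L ih =>
    rw [List.nodup_cons] at hnd
    have hL' : ∀ g ∈ L, g ∉ insert s B := fun i hi => hL i (List.mem_cons_of_mem _ hi)
    have hg : g ∉ insert s B := hL g (by simp)
    have hgs : g ≠ s := fun h => hg (by simp [h])
    have hgB : g ∉ B := fun h => hg (by simp [h])
    set μ : ι → Measure ℝ := fun _ : ι => volume.restrict (Set.Icc (0 : ℝ) 1) with hμ
    have hset : B ∪ (g :: L).toFinset = insert g (B ∪ L.toFinset) := by
      rw [List.toFinset_cons, Finset.union_insert]
    have hgn : g ∉ B ∪ L.toFinset := by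
      simp [hgB, hnd.1]
    have hsn : s ∉ B ∪ L.toFinset := by
      simp only [Finset.mem_union, List.mem_toFinset, not_or]
      exact ⟨hs, fun h => hL' s h (by simp)⟩
    have hmeas : Measurable ((strictMinSet B s).indicator (unmatchedBound (g :: L) (insert s B))) :=
      (measurable_unmatchedBound _ _).indicator (measurableSet_strictMinSet _ _)
    let F : (ι → ℝ) → ℝ≥0∞ := (strictMinSet B s).indicator (unmatchedBound L (insert s B))
    let G : (ι → ℝ) → ℝ≥0∞ := (strictMinSet B s).indicator (unmatchedBound L B)
    have hF : Measurable F :=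
      (measurable_unmatchedBound _ _).indicator (measurableSet_strictMinSet _ _)
    have hG : Measurable G :=
      (measurable_unmatchedBound _ _).indicator (measurableSet_strictMinSet _ _)
    have hinner : ∀ y : ι → ℝ, y s = x s →
        ENNReal.ofReal (x s) * F y + ENNReal.ofReal (1 - x s) * G y ≤
        ∫⁻ z, (strictMinSet B s).indicator (unmatchedBound (g :: L) (insert s B))
          (Function.update y g z) ∂μ g := by
      intro y hys
      by_cases hy : y ∈ strictMinSet B s
      · have hpt : ∀ z, (Set.Iio (x s)).indicator (fun _ => F y) z +
            (Set.Ioi (x s)).indicator (fun _ => G y) z ≤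
            (strictMinSet B s).indicator (unmatchedBound (g :: L) (insert s B))
              (Function.update y g z) := by
          intro z
          have hne : ∀ i, i ≠ g → Function.update y g z i = y i :=
            fun i hi => Function.update_of_ne hi _ _
          have hmem : Function.update y g z ∈ strictMinSet B s := by
            intro t ht
            rw [hne s hgs.symm, hne t (fun h => hgB (h ▸ ht))]
            exact hy t ht
          rw [Set.indicator_of_mem hmem]
          refine le_trans (le_of_eq ?_)
            (indicator_strictMinSet_le_unmatchedBound_cons g L hs _ hmem)
          have e1 : unmatchedBound L (insert s B) (Function.update y g z) = F y := by
            simp only [F]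
            rw [Set.indicator_of_mem hy]
            exact unmatchedBound_congr _ _ (fun i hi => hne i fun h => hg (h ▸ hi))
              (fun i hi => hne i fun h => hnd.1 (h ▸ hi))
          have e2 : unmatchedBound L B (Function.update y g z) = G y := by
            simp only [G]
            rw [Set.indicator_of_mem hy]
            exact unmatchedBound_congr _ _ (fun i hi => hne i fun h => hgB (h ▸ hi))
              (fun i hi => hne i fun h => hnd.1 (h ▸ hi))
          simp only [Set.indicator_apply, Set.mem_Iio, Set.mem_Ioi, Set.mem_ofPred_eq, e1, e2,
            Function.update_self, hne s hgs.symm, hys]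
        refine le_trans (le_of_eq ?_) (lintegral_mono hpt)
        rw [lintegral_add_left (measurable_const.indicator measurableSet_Iio),
          lintegral_indicator_const measurableSet_Iio, lintegral_indicator_const measurableSet_Ioi]
        simp only [hμ]
        rw [volume_restrict_Icc_Ioi hx.1, volume_restrict_Icc_Iio hx.2, mul_comm,
          mul_comm (G y)]
      · have e1 : F y = 0 := Set.indicator_of_notMem hy _
        have e2 : G y = 0 := Set.indicator_of_notMem hy _
        simp [e1, e2]
    rw [LeStrictMinMarginal, hset, lmarginal_insert' _ hmeas hgn]
    have hF' := ih B hs hnd.2 hL' x hx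
    have hG' : ENNReal.ofReal
        (B.card * (1 - x s) ^ B.card * (1 - (1 - x s) / (B.card + 1)) ^ L.length) ≤
        lmarginal μ (B ∪ L.toFinset) G x := by
      refine (le_lmarginal_of_leStrictMinMarginal L B
        (fun i hi h => hL' i hi (Finset.mem_insert_of_mem h)) ?_ hx.1 hx.2 x).trans
          (le_of_eq (lintegral_congr fun y => ?_))
      · intro t ht z hz
        refine ih (B.erase t) (Finset.notMem_erase t B) hnd.2 ?_ z hz
        rw [Finset.insert_erase ht]
        exact fun i hi h => hL' i hi (Finset.mem_insert_of_mem h)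
      · have hss : Function.updateFinset x (B ∪ L.toFinset) y s = x s := by
          simp only [Function.updateFinset, dif_neg hsn]
        simp only [G, Set.indicator_apply, strictMinSet, Set.mem_ofPred_eq, hss]
    calc _ ≤ ENNReal.ofReal (x s) * lmarginal μ (B ∪ L.toFinset) F x +
          ENNReal.ofReal (1 - x s) * lmarginal μ (B ∪ L.toFinset) G x := by
          refine le_trans (le_of_eq ?_)
            (add_le_add (mul_le_mul_right hF' _) (mul_le_mul_right hG' _))
          have hb : 0 ≤ 1 - (1 - x s) / ((B.card : ℝ) + 1) := by
            rw [sub_nonneg, div_le_one (by positivity)]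
            linarith [hx.1, (Nat.cast_nonneg B.card : (0 : ℝ) ≤ B.card)]
          have hv : 0 ≤ 1 - x s := by linarith [hx.2]
          have hp := pow_nonneg hb L.length
          have hq := pow_nonneg hv B.card
          rw [← ENNReal.ofReal_mul hx.1, ← ENNReal.ofReal_mul hv, ← ENNReal.ofReal_add]
          · congr 1
            rw [List.length_cons, pow_succ]
            generalize (1 - (1 - x s) / ((B.card : ℝ) + 1)) ^ L.length = p
            field_simp
            ring
          · exact mul_nonneg hx.1 (mul_nonneg (mul_nonneg hq (by positivity)) hp)
          · exact mul_nonneg hv (mul_nonneg (mul_nonneg (by positivity) hq) hp)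
      _ = lmarginal μ (B ∪ L.toFinset)
            (fun y => ENNReal.ofReal (x s) * F y + ENNReal.ofReal (1 - x s) * G y) x := by
          simp only [lmarginal]
          rw [lintegral_add_left, lintegral_const_mul, lintegral_const_mul]
          · exact hG.comp measurable_updateFinset
          · exact hF.comp measurable_updateFinset
          · exact (hF.comp measurable_updateFinset).const_mul _
      _ ≤ _ := by
          refine lintegral_mono fun y => hinner _ ?_
          simp only [Function.updateFinset, dif_neg hsn]

/-- Lower bound on the expected number of elements of `B` left unmatched. -/
theorem le_lintegral_unmatchedBound [Fintype ι] (L : List ι) (B : Finset ι) (hnd : L.Nodup)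
    (hL : ∀ g ∈ L, g ∉ B) (hU : B ∪ L.toFinset = Finset.univ) :
    ENNReal.ofReal (B.card * (1 - 1 / (B.card + 1)) ^ L.length) ≤
      ∫⁻ x, unmatchedBound L B x
        ∂(Measure.pi fun _ : ι => volume.restrict (Set.Icc (0 : ℝ) 1)) := by
  have h := le_lmarginal_of_leStrictMinMarginal L B hL (c := 0) (fun t ht z hz => by
    refine leStrictMinMarginal L (B.erase t) (Finset.notMem_erase t B) hnd ?_ z hz
    rwa [Finset.insert_erase ht]) le_rfl zero_le_one 0
  rw [hU, lmarginal_univ] at h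
  simp only [sub_zero, one_pow, mul_one] at h
  exact h.trans (lintegral_mono fun x => Set.indicator_le_self _ _ x)

end Bound

theorem rankingStep_eq_insert {n : ℕ} (y : Fin n → ℝ) (M N : Finset (Fin n)) {s : Fin n}
    (hs : s ∈ N \ M) (hmin : ∀ t ∈ N \ M, t ≠ s → y s < y t) :
    rankingStep y M N = insert s M := by
  unfold rankingStep
  split
  · rename_i m hm
    have h1 : m ∈ N \ M := Finset.mem_toList.1 (List.argmin_mem hm)
    have h2 : y m ≤ y s := List.le_of_mem_argmin (Finset.mem_toList.2 hs) hm
    by_cases h : m = s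
    · rw [h]
    · exact absurd (hmin m h1 h) h2.not_gt
  · rename_i hm
    rw [List.argmin_eq_none, Finset.toList_eq_nil] at hm
    rw [hm] at hs
    exact absurd hs (Finset.notMem_empty s)

theorem rankingStep_subset {n : ℕ} (y : Fin n → ℝ) (M N : Finset (Fin n)) :
    rankingStep y M N ⊆ M ∪ N := by
  unfold rankingStep
  split
  · rename_i m hm
    have h1 : m ∈ N \ M := Finset.mem_toList.1 (List.argmin_mem hm)
    exact Finset.insert_subset (Finset.mem_union_right _ (Finset.mem_sdiff.1 h1).1)
      Finset.subset_union_left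
  · exact Finset.subset_union_left

theorem sdiff_subset_sdiff_foldl_rankingStep {n : ℕ} (y : Fin n → ℝ) (A : Finset (Fin n))
    (Ns : List (Finset (Fin n))) (hA : ∀ N ∈ Ns, Disjoint A N) (M : Finset (Fin n)) :
    A \ M ⊆ A \ Ns.foldl (rankingStep y) M := by
  induction Ns generalizing M with
  | nil => exact subset_rfl
  | cons N Ns ih =>
    refine subset_trans (fun s hs => ?_) (ih (fun K hK => hA K (by simp [hK])) _)
    rw [Finset.mem_sdiff] at hs ⊢
    refine ⟨hs.1, fun h => ?_⟩
    rcases Finset.mem_union.1 (rankingStep_subset y M N h) with h | h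
    · exact hs.2 h
    · exact Finset.disjoint_left.1 (hA N (by simp)) hs.1 h

theorem unmatchedBound_le_card_sdiff {n : ℕ} (y : Fin n → ℝ) (A : Finset (Fin n))
    (L : List (Fin n)) (M : Finset (Fin n)) (hnd : L.Nodup) (hA : ∀ g ∈ L, g ∉ A)
    (hM : ∀ g ∈ L, g ∉ M) :
    unmatchedBound L (A \ M) y ≤
      ((A \ (L.map fun g => insert g A).foldl (rankingStep y) M).card : ℝ≥0∞) := by
  induction L generalizing M with
  | nil => exact le_rfl
  | cons g L ih =>
    rw [List.nodup_cons] at hnd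
    have hgA : g ∉ A := hA g (by simp)
    have hgM : g ∉ M := hM g (by simp)
    have hA' : ∀ g ∈ L, g ∉ A := fun i hi => hA i (by simp [hi])
    have hM' : ∀ g ∈ L, g ∉ M := fun i hi => hM i (by simp [hi])
    have hN : insert g A \ M = insert g (A \ M) := Finset.insert_sdiff_of_notMem _ hgM
    rw [unmatchedBound, List.map_cons, List.foldl_cons]
    refine sum_indicator_strictMinSet_le _ _ _ _ fun s hs hy => ?_
    have hsA := Finset.mem_sdiff.1 hs
    have hsg : s ≠ g := fun h => hgA (h ▸ hsA.1)
    have hmin : ∀ t ∈ A \ M, t ≠ s → y s < y t := fun t ht hts =>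
      hy t (Finset.mem_erase.2 ⟨hts, ht⟩)
    rcases lt_trichotomy (y g) (y s) with h | h | h
    · rw [Set.indicator_of_mem (by exact h), Set.indicator_of_notMem (by exact h.not_gt), add_zero,
        rankingStep_eq_insert y M (insert g A) (s := g)]
      · have e : A \ M = A \ insert g M := by
          rw [Finset.sdiff_insert, Finset.erase_eq_of_notMem]
          exact fun h => hgA (Finset.mem_sdiff.1 h).1
        rw [e]
        refine ih _ hnd.2 hA' fun i hi h => ?_
        rcases Finset.mem_insert.1 h with rfl | h
        · exact hnd.1 hi
        · exact hM' i hi h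
      · rw [hN]; exact Finset.mem_insert_self _ _
      · rw [hN]
        intro t ht htg
        have ht' := (Finset.mem_insert.1 ht).resolve_left htg
        by_cases hts : t = s
        · rwa [hts]
        · exact h.trans (hmin t ht' hts)
    · rw [Set.indicator_of_notMem (by exact h.not_lt), Set.indicator_of_notMem (by exact h.not_gt),
        add_zero]
      exact zero_le
    · rw [Set.indicator_of_notMem (by exact h.not_gt), Set.indicator_of_mem (by exact h), zero_add,
        rankingStep_eq_insert y M (insert g A) (s := s)]
      · rw [← Finset.sdiff_insert]
        refine ih _ hnd.2 hA' fun i hi h => ?_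
        rcases Finset.mem_insert.1 h with rfl | h
        · exact hA' i hi hsA.1
        · exact hM' i hi h
      · rw [hN]; exact Finset.mem_insert_of_mem hs
      · rw [hN]
        intro t ht hts
        rcases Finset.mem_insert.1 ht with rfl | ht
        · exact h
        · exact hmin t ht hts

instance isProbabilityMeasure_uniformCube (n : ℕ) : IsProbabilityMeasure (uniformCube n) := by
  have : IsProbabilityMeasure (volume.restrict (Set.Icc (0 : ℝ) 1)) :=
    ⟨by simp⟩
  unfold uniformCube
  infer_instance

/-- The requests `insert g A`, for `g ∈ L`, followed by requests of the servers outside `A`, cause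
Ranking to leave many servers unmatched in expectation. -/
theorem integral_card_rankingMatched_le {n : ℕ} (A : Finset (Fin n)) (L : List (Fin n))
    (hnd : L.Nodup) (hL : ∀ g, g ∈ L ↔ g ∉ A) (Ns : List (Finset (Fin n)))
    (hNs : ∀ N ∈ Ns, Disjoint A N) :
    ∫ y, ((rankingMatched y ((L.map fun g => insert g A) ++ Ns)).card : ℝ) ∂(uniformCube n) ≤
      n - A.card * (1 - 1 / (A.card + 1 : ℝ)) ^ L.length := by
  set f : (Fin n → ℝ) → ℝ :=
    fun y => ((rankingMatched y ((L.map fun g => insert g A) ++ Ns)).card : ℝ)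
  set q : ℝ := A.card * (1 - 1 / (A.card + 1 : ℝ)) ^ L.length
  have hb0 : 0 ≤ 1 - 1 / (A.card + 1 : ℝ) := by
    rw [sub_nonneg, div_le_one (by positivity)]
    linarith [(Nat.cast_nonneg A.card : (0 : ℝ) ≤ A.card)]
  have hb1 : 1 - 1 / (A.card + 1 : ℝ) ≤ 1 := by
    rw [sub_le_self_iff]; positivity
  have hq0 : 0 ≤ q := mul_nonneg (Nat.cast_nonneg _) (pow_nonneg hb0 _)
  have hqn : q ≤ n := by
    refine (mul_le_of_le_one_right (Nat.cast_nonneg _) (pow_le_one₀ hb0 hb1)).trans ?_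
    exact_mod_cast card_finset_fin_le A
  by_cases hf : Integrable f (uniformCube n)
  swap
  · rw [integral_undef hf]
    linarith
  have hpt : ∀ y, ENNReal.ofReal (f y) + unmatchedBound L A y ≤ n := by
    intro y
    have h1 := unmatchedBound_le_card_sdiff y A L ∅ hnd (fun g hg => (hL g).1 hg) (by simp)
    rw [Finset.sdiff_empty] at h1
    have h2 := Finset.card_le_card (sdiff_subset_sdiff_foldl_rankingStep y A Ns hNs
      ((L.map fun g => insert g A).foldl (rankingStep y) ∅))
    rw [← List.foldl_append] at h2
    have h3 : (rankingMatched y ((L.map fun g => insert g A) ++ Ns)).card +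
        (A \ rankingMatched y ((L.map fun g => insert g A) ++ Ns)).card ≤ n := by
      rw [← Finset.card_union_of_disjoint Finset.disjoint_sdiff]
      exact card_finset_fin_le _
    simp only [f, ENNReal.ofReal_natCast]
    refine (add_le_add le_rfl h1).trans ?_
    refine (add_le_add le_rfl (Nat.cast_le.2 h2)).trans ?_
    exact_mod_cast h3
  have hint : ENNReal.ofReal (∫ y, f y ∂(uniformCube n)) + ENNReal.ofReal q ≤ n := by
    rw [ofReal_integral_eq_lintegral_ofReal hf (Filter.Eventually.of_forall fun y => by positivity)]
    have hU := le_lintegral_unmatchedBound L A hnd (fun g hg => (hL g).1 hg) (by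
      ext g
      simp only [Finset.mem_union, List.mem_toFinset, Finset.mem_univ, iff_true, hL]
      exact em _)
    refine (add_le_add le_rfl hU).trans ?_
    have : ∫⁻ y, (ENNReal.ofReal (f y) + unmatchedBound L A y) ∂(uniformCube n) ≤ n := by
      refine (lintegral_mono hpt).trans ?_
      simp
    rwa [lintegral_add_right _ (measurable_unmatchedBound L A)] at this
  have hf0 : 0 ≤ ∫ y, f y ∂(uniformCube n) := integral_nonneg fun y => by positivity
  rw [← ENNReal.ofReal_add hf0 hq0, ENNReal.ofReal_le_natCast] at hint
  linarith

theorem matchingSize_le {n : ℕ} (Ns : List (Finset (Fin n))) (g : Fin Ns.length → Option (Fin n))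
    (hg : IsMatching Ns g) : matchingSize Ns g ≤ n := by
  have h : ((Finset.univ.filter fun i => (g i).isSome).image g).card ≤
      (Finset.univ.image (some : Fin n → Option (Fin n))).card := by
    refine Finset.card_le_card fun o ho => ?_
    obtain ⟨i, hi, rfl⟩ := Finset.mem_image.1 ho
    obtain ⟨s, hs⟩ := Option.isSome_iff_exists.1 (Finset.mem_filter.1 hi).2
    exact Finset.mem_image.2 ⟨s, Finset.mem_univ s, hs.symm⟩
  rw [Finset.card_image_of_injOn, Finset.card_image_of_injective _ (Option.some_injective _),
    Finset.card_univ, Fintype.card_fin] at h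
  · exact h
  · intro i hi j hj hij
    obtain ⟨s, hs⟩ := Option.isSome_iff_exists.1 (Finset.mem_filter.1 hi).2
    exact hg.2 i j s hs (by rw [← hs]; exact hij.symm)

/-- An injective choice of an adjacent request for every server is a perfect matching. -/
theorem exists_isMatching_of_injective {n : ℕ} (Ns : List (Finset (Fin n)))
    (r : Fin n → Fin Ns.length) (hr : Function.Injective r) (hadj : ∀ s, s ∈ Ns.get (r s)) :
    ∃ g, IsMatching Ns g ∧ matchingSize Ns g = n := by
  classical
  let g : Fin Ns.length → Option (Fin n) := fun i =>
    if h : ∃ s, r s = i then some h.choose else none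
  have hg : ∀ i s, g i = some s ↔ r s = i := by
    intro i s
    simp only [g]
    split
    · rename_i h
      rw [Option.some_inj]
      constructor
      · rintro rfl; exact h.choose_spec
      · intro hs; exact hr (h.choose_spec.trans hs.symm)
    · rename_i h
      simp only [reduceCtorEq, false_iff]
      exact fun hs => h ⟨s, hs⟩
  have hm : IsMatching Ns g := by
    refine ⟨fun i s h => ?_, fun i j s hi hj => ?_⟩
    · rw [← (hg i s).1 h]; exact hadj s
    · rw [← (hg i s).1 hi, (hg j s).1 hj]
  refine ⟨g, hm, le_antisymm (matchingSize_le Ns g hm) ?_⟩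
  have h : (Finset.univ.image r).card ≤ matchingSize Ns g := by
    refine Finset.card_le_card fun i hi => ?_
    obtain ⟨s, -, hs⟩ := Finset.mem_image.1 hi
    rw [Finset.mem_filter, (hg i s).2 hs]
    exact ⟨Finset.mem_univ _, rfl⟩
  rwa [Finset.card_image_of_injective _ hr, Finset.card_univ, Fintype.card_fin] at h

/-- For all `k ≥ d ≥ 2` there is a `(k,d)`-bounded bipartite graph (every request of
degree at most `d`, every server of degree at least `k`), with maximum matching size
`OPT > 0`, on which the expected size of the matching produced by Ranking is at most
`(1 - ((1-1/d)^k · (d-1))/(k+d-1)) · OPT`. -/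
theorem ranking_upper_bound_on_kd_bounded_graphs (k d : ℕ) (hd : 2 ≤ d) (hk : d ≤ k) :
    ∃ (ns : ℕ) (Ns : List (Finset (Fin ns))) (OPT : ℕ),
      0 < OPT ∧
      (∀ N ∈ Ns, N.card ≤ d) ∧
      (∀ s : Fin ns, k ≤ Ns.countP fun N => decide (s ∈ N)) ∧
      (∃ g, IsMatching Ns g ∧ matchingSize Ns g = OPT) ∧
      (∀ g, IsMatching Ns g → matchingSize Ns g ≤ OPT) ∧
      ∫ y, ((rankingMatched y Ns).card : ℝ) ∂(uniformCube ns) ≤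
        (1 - (1 - 1 / (d : ℝ)) ^ k * ((d : ℝ) - 1) / ((k : ℝ) + d - 1)) * OPT := by
  obtain ⟨n, rfl⟩ : ∃ n, d = n + 1 := ⟨d - 1, by omega⟩
  let A : Finset (Fin (n + k)) := Finset.univ.map (Fin.castAddEmb k)
  let L : List (Fin (n + k)) := (List.finRange k).map (Fin.natAdd n)
  let Ns₂ : List (Finset (Fin (n + k))) :=
    L.map (fun g => {g}) ++ L.flatMap fun g => List.replicate k {g}
  have hAcard : A.card = n := by simp [A]
  have hLlen : L.length = k := by simp [L]
  have hmemA : ∀ s, s ∈ A ↔ s.val < n := by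
    intro s
    simp only [A, Finset.mem_map, Finset.mem_univ, true_and, Fin.castAddEmb_apply]
    constructor
    · rintro ⟨i, rfl⟩; simp
    · intro h; exact ⟨⟨s, h⟩, rfl⟩
  have hmemL : ∀ s, s ∈ L ↔ s ∉ A := by
    intro s
    rw [hmemA]
    simp only [L, List.mem_map, List.mem_finRange, true_and, not_lt]
    constructor
    · rintro ⟨i, rfl⟩; simp
    · intro h; exact ⟨⟨s - n, by omega⟩, Fin.ext (by simp [h])⟩
  have hnd : L.Nodup := (List.nodup_finRange k).map (Fin.natAdd_injective k n)
  have hNs₂ : ∀ N ∈ Ns₂, ∃ g ∈ L, N = {g} := by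
    intro N hN
    simp only [Ns₂, List.mem_append, List.mem_map, List.mem_flatMap, List.mem_replicate] at hN
    rcases hN with ⟨g, hg, rfl⟩ | ⟨g, hg, -, rfl⟩ <;> exact ⟨g, hg, rfl⟩
  have hlen : n + k ≤ ((L.map fun g => insert g A) ++ Ns₂).length := by
    simp only [Ns₂, List.length_append, List.length_map, hLlen]
    omega
  refine ⟨n + k, (L.map fun g => insert g A) ++ Ns₂, n + k, by omega, ?_, ?_, ?_,
    fun g hg => matchingSize_le _ g hg, ?_⟩
  · intro N hN
    rcases List.mem_append.1 hN with hN | hN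
    · obtain ⟨g, -, rfl⟩ := List.mem_map.1 hN
      exact (Finset.card_insert_le _ _).trans (by rw [hAcard])
    · obtain ⟨g, -, rfl⟩ := hNs₂ N hN
      simp
  · intro s
    rw [List.countP_append]
    by_cases hs : s ∈ A
    · refine le_add_right (le_of_eq ?_)
      rw [List.countP_eq_length.2, List.length_map, hLlen]
      intro N hN
      obtain ⟨g, -, rfl⟩ := List.mem_map.1 hN
      simp [hs]
    · refine le_add_left ?_
      have hsub : (List.replicate k {s}).Sublist Ns₂ := by
        refine List.Sublist.trans ?_ (List.sublist_append_right _ _)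
        rw [List.flatMap_def]
        exact List.sublist_flatten_of_mem (List.mem_map.2 ⟨s, (hmemL s).2 hs, rfl⟩)
      refine le_trans (le_of_eq ?_) hsub.countP_le
      rw [List.countP_replicate]
      simp
  · let r : Fin (n + k) → Fin ((L.map fun g => insert g A) ++ Ns₂).length := fun s =>
      if h : s.val < n then ⟨s, by omega⟩ else
        ⟨k + (s - n), by
          simp only [Ns₂, List.length_append, List.length_map, hLlen]
          omega⟩
    refine exists_isMatching_of_injective _ r (fun s t hst => ?_) fun s => ?_
    · simp only [r] at hst
      ext
      split at hst <;> split at hst <;> simp only [Fin.mk.injEq] at hst <;> omega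
    · simp only [r]
      by_cases hs : s.val < n
      · rw [dif_pos hs, List.get_eq_getElem, List.getElem_append_left (by
          simp only [List.length_map, hLlen]; omega), List.getElem_map]
        exact Finset.mem_insert_of_mem ((hmemA s).2 hs)
      · rw [dif_neg hs, List.get_eq_getElem, List.getElem_append_right (by
          simp only [List.length_map, hLlen]; omega)]
        simp only [Ns₂]
        rw [List.getElem_append_left (by simp only [List.length_map, hLlen]; omega),
          List.getElem_map, Finset.mem_singleton]
        ext
        simp only [L, List.getElem_map, List.getElem_finRange, List.length_map,
          List.length_finRange, Fin.val_natAdd, Fin.val_cast]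
        omega
  · have h := integral_card_rankingMatched_le A L hnd hmemL Ns₂ (by
      intro N hN
      obtain ⟨g, hg, rfl⟩ := hNs₂ N hN
      exact Finset.disjoint_singleton_right.2 ((hmemL g).1 hg))
    rw [hAcard, hLlen] at h
    refine h.trans (le_of_eq ?_)
    push_cast
    have hpos : (k : ℝ) + (n + 1) - 1 ≠ 0 := by
      have : (2 : ℝ) ≤ k := by exact_mod_cast hd.trans hk
      have := (Nat.cast_nonneg n : (0 : ℝ) ≤ n)
      linarith
    generalize (1 - 1 / ((n : ℝ) + 1)) ^ k = p
    field_simp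
    ring
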